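/- In S = R[X;σ,δ]^fl, the element X lies in the middle nucleus N_m(S) (i.e. (p·X)·q = p·(X·q) for all p, q ∈ S) if and only if for every n ∈ ℕ the image of δ^n ∘ σ is contained in the commuter C(R), i.e. δ^n(σ(s)) commutes with every element of R for all s ∈ R and n ∈ ℕ. -/

import Mathlib

/-- The π-functions `piFun σ δ m i = π_i^m`. -/
def piFun {R : Type*} [NonAssocRing R] (σ δ : R → R) : ℕ → ℕ → R → R
  | 0, 0, r => r
  | 0, _+1, _ => 0
  | m+1, 0, r => δ (piFun σ δ m 0 r)
  | m+1, i+1, r => σ (piFun σ δ m i r) + δ (piFun σ δ m (i+1) r)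

/-- `tau n r s = rs` if `n` is even and `sr` if `n` is odd. -/
def tau {R : Type*} [NonAssocRing R] (n : ℕ) (r s : R) : R :=
  if Even n then r * s else s * r

/-- The multiplication of the flipped generalized polynomial ring `R[X;σ,δ]^fl`:
the biadditive extension of `(rX^m)(sX^n) = Σ_i τ_n(r, π_i^m(s)) X^{i+n}`. Polynomials
are represented as finitely supported functions `ℕ →₀ R`. -/
noncomputable def flipMul {R : Type*} [NonAssocRing R] (σ δ : R → R) (p q : ℕ →₀ R) : ℕ →₀ R :=
  p.sum fun m r => q.sum fun n s =>
    ∑ i ∈ Finset.range (m+1), Finsupp.single (i+n) (tau n r (piFun σ δ m i s))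

section piFun

variable {R : Type*} [NonAssocRing R] (σ δ : R →+ R)

theorem piFun_add (m i : ℕ) (r s : R) :
    piFun σ δ m i (r + s) = piFun σ δ m i r + piFun σ δ m i s := by
  induction m generalizing i with
  | zero => cases i <;> simp [piFun]
  | succ m ih =>
    cases i with
    | zero => simp [piFun, ih]
    | succ i => simp only [piFun, ih, map_add]; abel

theorem piFun_zero_right (m i : ℕ) : piFun σ δ m i 0 = 0 := by
  have h := piFun_add σ δ m i 0 0
  simpa using h

theorem piFun_eq_zero_of_lt {m i : ℕ} (h : m < i) (r : R) : piFun σ δ m i r = 0 := by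
  induction m generalizing i with
  | zero => cases i with
    | zero => omega
    | succ i => rfl
  | succ m ih => cases i with
    | zero => omega
    | succ i => simp [piFun, ih (show m < i by omega), ih (show m < i + 1 by omega)]

theorem piFun_zero_index (m : ℕ) (r : R) : piFun σ δ m 0 r = δ^[m] r := by
  induction m with
  | zero => rfl
  | succ m ih => rw [Function.iterate_succ_apply', ← ih]; rfl

/-- The recursion for the π-functions with the additional map applied first. -/
theorem piFun_succ_succ (m i : ℕ) (r : R) :
    piFun σ δ (m + 1) (i + 1) r = piFun σ δ m i (σ r) + piFun σ δ m (i + 1) (δ r) := by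
  induction m generalizing i with
  | zero => cases i <;> simp [piFun]
  | succ m ih =>
    rw [piFun, ih i]
    cases i with
    | zero =>
      have h : piFun σ δ (m + 1) 0 r = piFun σ δ m 0 (δ r) := by
        simp only [piFun_zero_index, Function.iterate_succ_apply]
      rw [h]
      simp only [piFun, map_add]
      abel
    | succ i =>
      rw [ih i]
      simp only [piFun, map_add]
      abel

theorem piFun_one (hσ : σ 1 = 1) (hδ : δ 1 = 0) (m i : ℕ) :
    piFun σ δ m i 1 = if i = m then 1 else 0 := by
  induction m generalizing i with
  | zero => cases i <;> simp [piFun]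
  | succ m ih =>
    cases i with
    | zero => simp only [piFun, ih]; split_ifs <;> simp_all
    | succ i => simp only [piFun, ih]; split_ifs <;> simp_all

theorem iterate_piFun_map_mul_comm
    (h : ∀ (n : ℕ) (s r : R), δ^[n] (σ s) * r = r * δ^[n] (σ s)) (m i k : ℕ) (s r : R) :
    δ^[k] (piFun σ δ m i (σ s)) * r = r * δ^[k] (piFun σ δ m i (σ s)) := by
  induction m generalizing i k with
  | zero => cases i with
    | zero => exact h k s r
    | succ i => simp [piFun, iterate_map_zero]
  | succ m ih => cases i with
    | zero => exact ih 0 (k + 1)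
    | succ i =>
      rw [piFun, iterate_map_add, add_mul, mul_add, h, ← Function.iterate_succ_apply, ih]

end piFun

section tau

variable {R : Type*} [NonAssocRing R]

theorem tau_add_left (n : ℕ) (r r' s : R) : tau n (r + r') s = tau n r s + tau n r' s := by
  unfold tau; split_ifs <;> simp [add_mul, mul_add]

theorem tau_add_right (n : ℕ) (r s s' : R) : tau n r (s + s') = tau n r s + tau n r s' := by
  unfold tau; split_ifs <;> simp [add_mul, mul_add]

@[simp]
theorem tau_zero_left (n : ℕ) (s : R) : tau n 0 s = 0 := by simp [tau]

@[simp]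
theorem tau_zero_right (n : ℕ) (r : R) : tau n r 0 = 0 := by simp [tau]

@[simp]
theorem tau_one_left (n : ℕ) (s : R) : tau n 1 s = s := by simp [tau]

@[simp]
theorem tau_one_right (n : ℕ) (r : R) : tau n r 1 = r := by simp [tau]

theorem tau_eq_tau_of_mul_comm {r s : R} (h : s * r = r * s) (m n : ℕ) :
    tau m r s = tau n r s := by
  unfold tau; split_ifs <;> simp [h]

end tau

section flipMul

variable {R : Type*} [NonAssocRing R] (σ δ : R →+ R)

theorem flipMul_zero_left (q : ℕ →₀ R) : flipMul σ δ 0 q = 0 := by simp [flipMul]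

theorem flipMul_zero_right (p : ℕ →₀ R) : flipMul σ δ p 0 = 0 := by simp [flipMul]

theorem flipMul_add_left (p p' q : ℕ →₀ R) :
    flipMul σ δ (p + p') q = flipMul σ δ p q + flipMul σ δ p' q := by
  unfold flipMul
  refine Finsupp.sum_add_index' (by simp) fun m r r' => ?_
  simp only [tau_add_left, Finsupp.single_add, Finset.sum_add_distrib, Finsupp.sum_add]

theorem flipMul_add_right (p q q' : ℕ →₀ R) :
    flipMul σ δ p (q + q') = flipMul σ δ p q + flipMul σ δ p q' := by
  unfold flipMul
  rw [← Finsupp.sum_add]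
  refine Finsupp.sum_congr fun m _ => ?_
  refine Finsupp.sum_add_index' (by simp [piFun_zero_right]) fun n s s' => ?_
  simp only [piFun_add, tau_add_right, Finsupp.single_add, Finset.sum_add_distrib]

theorem flipMul_single_single (m n : ℕ) (r s : R) :
    flipMul σ δ (Finsupp.single m r) (Finsupp.single n s) =
      ∑ i ∈ Finset.range (m + 1), Finsupp.single (i + n) (tau n r (piFun σ δ m i s)) := by
  unfold flipMul
  rw [Finsupp.sum_single_index (by simp), Finsupp.sum_single_index (by simp [piFun_zero_right])]

theorem flipMul_single_X (hσ : σ 1 = 1) (hδ : δ 1 = 0) (m : ℕ) (r : R) :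
    flipMul σ δ (Finsupp.single m r) (Finsupp.single 1 1) = Finsupp.single (m + 1) r := by
  rw [flipMul_single_single, Finset.sum_range_succ, Finset.sum_eq_zero fun i hi => ?_]
  · simp [piFun_one σ δ hσ hδ]
  · rw [piFun_one σ δ hσ hδ, if_neg (Finset.mem_range.mp hi).ne]
    simp

theorem flipMul_X_single (n : ℕ) (s : R) :
    flipMul σ δ (Finsupp.single 1 1) (Finsupp.single n s) =
      Finsupp.single n (δ s) + Finsupp.single (n + 1) (σ s) := by
  simp [flipMul_single_single, Finset.sum_range_succ, piFun, add_comm 1 n]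

theorem flipMul_single_succ_single (m n : ℕ) (r s : R) :
    flipMul σ δ (Finsupp.single (m + 1) r) (Finsupp.single n s) =
      flipMul σ δ (Finsupp.single m r) (Finsupp.single n (δ s)) +
        ∑ i ∈ Finset.range (m + 1),
          Finsupp.single (i + (n + 1)) (tau n r (piFun σ δ m i (σ s))) := by
  have h : piFun σ δ (m + 1) 0 s = piFun σ δ m 0 (δ s) := by
    simp only [piFun_zero_index, Function.iterate_succ_apply]
  have h' : ∑ i ∈ Finset.range (m + 1),
      Finsupp.single (i + n) (tau n r (piFun σ δ m i (δ s))) =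
      ∑ i ∈ Finset.range (m + 1 + 1),
        Finsupp.single (i + n) (tau n r (piFun σ δ m i (δ s))) := by
    rw [Finset.sum_range_succ _ (m + 1), piFun_eq_zero_of_lt σ δ m.lt_succ_self]
    simp
  rw [flipMul_single_single, flipMul_single_single, h', Finset.sum_range_succ' _ (m + 1),
    Finset.sum_range_succ' _ (m + 1), h]
  simp only [piFun_succ_succ, tau_add_right, Finsupp.single_add, Finset.sum_add_distrib,
    add_assoc, add_comm 1 n]
  abel

/-- Associativity of a monomial, `X` and a monomial, with the common part cancelled. -/
theorem flipMul_single_X_single_assoc_iff (hσ : σ 1 = 1) (hδ : δ 1 = 0) (m n : ℕ) (r s : R) :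
    flipMul σ δ (flipMul σ δ (Finsupp.single m r) (Finsupp.single 1 1)) (Finsupp.single n s) =
        flipMul σ δ (Finsupp.single m r)
          (flipMul σ δ (Finsupp.single 1 1) (Finsupp.single n s)) ↔
      ∑ i ∈ Finset.range (m + 1),
          Finsupp.single (i + (n + 1)) (tau n r (piFun σ δ m i (σ s))) =
        ∑ i ∈ Finset.range (m + 1),
          Finsupp.single (i + (n + 1)) (tau (n + 1) r (piFun σ δ m i (σ s))) := by
  rw [flipMul_single_X σ δ hσ hδ, flipMul_X_single, flipMul_add_right,
    flipMul_single_succ_single, flipMul_single_single _ _ m (n + 1), add_right_inj]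

end flipMul

/-- in `S = R[X;σ,δ]^fl`, `X` lies in the middle nucleus `N_m(S)` if and only
if for every `n ∈ ℕ` the image of `δ^n ∘ σ` is contained in the commuter `C(R)`. -/
theorem X_mem_middleNucleus_iff {R : Type*} [NonAssocRing R]
    (σ δ : R →+ R) (hσ : σ 1 = 1) (hδ : δ 1 = 0) :
    (∀ p q : ℕ →₀ R,
      flipMul (σ : R → R) (δ : R → R)
          (flipMul (σ : R → R) (δ : R → R) p (Finsupp.single 1 1)) q
        = flipMul (σ : R → R) (δ : R → R) p
            (flipMul (σ : R → R) (δ : R → R) (Finsupp.single 1 1) q)) ↔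
    (∀ (n : ℕ) (s r : R), (δ : R → R)^[n] (σ s) * r = r * (δ : R → R)^[n] (σ s)) := by
  constructor
  · intro h n s r
    have h₁ := (flipMul_single_X_single_assoc_iff σ δ hσ hδ n 0 r s).mp (h _ _)
    have h₂ := DFunLike.congr_fun h₁ 1
    simpa [Finsupp.finsetSum_apply, Finsupp.single_apply, tau, piFun_zero_index] using h₂.symm
  · intro h p q
    induction p using Finsupp.induction_linear with
    | zero => simp only [flipMul_zero_left]
    | add p p' hp hp' => simp only [flipMul_add_left, hp, hp']
    | single m r =>
      induction q using Finsupp.induction_linear with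
      | zero => simp only [flipMul_zero_right]
      | add q q' hq hq' => simp only [flipMul_add_right, hq, hq']
      | single n s =>
        refine (flipMul_single_X_single_assoc_iff σ δ hσ hδ m n r s).mpr ?_
        refine Finset.sum_congr rfl fun i _ => ?_
        exact congrArg _ (tau_eq_tau_of_mul_comm
          (iterate_piFun_map_mul_comm σ δ h m i 0 s r) n (n + 1))
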